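/- For every admissible update sequence U, after the SF_2-sketch processes U starting from all-zero subsketches, every counter of the Slim-subsketch is at most the corresponding counter of the Deletion-subsketch: for all i : Fin d and j : Fin w, A i j ≤ C i j. (The invariant the paper establishes for SF_2 to justify its deletion operation.) -/

import Mathlib

/-- An update operation: insertion or deletion of an item. -/
inductive SketchOp (ι : Type) where
  | ins (e : ι)
  | del (e : ι)
deriving DecidableEq

/-- The state of the SF_2-sketch: a Slim-subsketch `A`, a Fat-subsketch `B`,
and a Deletion-subsketch `C`. -/
structure SF2State (d w w' : ℕ) where
  A : Fin d → Fin w → ℕ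
  B : Fin d → Fin w' → ℕ
  C : Fin d → Fin w → ℕ

/-- One update step of the SF_2-sketch.

Insertion of `e`: each `B i (g i e)` and each `C i (h i e)` is incremented by 1;
then, with `Bmin` the minimum over `i` of the updated `B i (g i e)`, every Slim
counter `A i (h i e)` whose value equals the minimum over `i'` of `A i' (h i' e)`
and is `< Bmin` is incremented by 1; other Slim counters are unchanged.

Deletion of `e`: each `B i (g i e)` and each `C i (h i e)` is decremented by 1;
then each Slim counter `A i (h i e)` is replaced by
`min (A i (h i e)) (updated C i (h i e))`. -/
def sf2Step {ι : Type} {d w w' : ℕ} [NeZero d] (h : Fin d → ι → Fin w)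
    (g : Fin d → ι → Fin w') (st : SF2State d w w') :
    SketchOp ι → SF2State d w w'
  | .ins e =>
      let B' : Fin d → Fin w' → ℕ :=
        fun i j => if j = g i e then st.B i j + 1 else st.B i j
      let C' : Fin d → Fin w → ℕ :=
        fun i j => if j = h i e then st.C i j + 1 else st.C i j
      let Bmin := Finset.univ.inf' Finset.univ_nonempty (fun i => B' i (g i e))
      let Amin := Finset.univ.inf' Finset.univ_nonempty
        (fun i' => st.A i' (h i' e))
      let A' : Fin d → Fin w → ℕ :=
        fun i j =>
          if j = h i e ∧ st.A i (h i e) = Amin ∧ st.A i (h i e) < Bmin then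
            st.A i j + 1
          else st.A i j
      ⟨A', B', C'⟩
  | .del e =>
      let B' : Fin d → Fin w' → ℕ :=
        fun i j => if j = g i e then st.B i j - 1 else st.B i j
      let C' : Fin d → Fin w → ℕ :=
        fun i j => if j = h i e then st.C i j - 1 else st.C i j
      let A' : Fin d → Fin w → ℕ :=
        fun i j => if j = h i e then min (st.A i j) (C' i j) else st.A i j
      ⟨A', B', C'⟩

/-- The state of the SF_2-sketch after processing the update sequence `U`
starting from all-zero subsketches. -/
def sf2Process {ι : Type} {d w w' : ℕ} [NeZero d] (h : Fin d → ι → Fin w)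
    (g : Fin d → ι → Fin w') (U : List (SketchOp ι)) : SF2State d w w' :=
  U.foldl (sf2Step h g) ⟨fun _ _ => 0, fun _ _ => 0, fun _ _ => 0⟩

/-- For every admissible update sequence (immediately before every deletion of
an item `e`, all counters `C i (h i e)` and `B i (g i e)` are at least 1), after
the SF_2-sketch processes the sequence, every Slim counter is at most the
corresponding counter of the Deletion-subsketch. -/
theorem sf2_slim_le_deletion {ι : Type} {d w w' : ℕ} [NeZero d] [NeZero w]
    [NeZero w'] (h : Fin d → ι → Fin w) (g : Fin d → ι → Fin w')
    (U : List (SketchOp ι))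
    (hadm : ∀ (V : List (SketchOp ι)) (e : ι) (rest : List (SketchOp ι)),
      U = V ++ SketchOp.del e :: rest →
      ∀ i : Fin d, 1 ≤ (sf2Process h g V : SF2State d w w').C i (h i e) ∧
        1 ≤ (sf2Process h g V : SF2State d w w').B i (g i e)) :
    ∀ (i : Fin d) (j : Fin w),
      (sf2Process h g U : SF2State d w w').A i j ≤ (sf2Process h g U).C i j := by
  clear hadm
  unfold sf2Process
  have step : ∀ (st : SF2State d w w') (op : SketchOp ι),
      (∀ i j, st.A i j ≤ st.C i j) →
      ∀ i j, (sf2Step h g st op).A i j ≤ (sf2Step h g st op).C i j := by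
    intro st op hst i j
    have hij := hst i j
    cases op with
    | ins e =>
      simp only [sf2Step]
      by_cases hj : j = h i e
      · rw [if_pos hj]
        split_ifs <;> omega
      · rw [if_neg hj, if_neg (fun hc => hj hc.1)]
        exact hij
    | del e =>
      simp only [sf2Step]
      by_cases hj : j = h i e
      · simp only [if_pos hj]
        exact min_le_right _ _
      · simp only [if_neg hj]
        exact hij
  have fold : ∀ (U : List (SketchOp ι)) (st : SF2State d w w'),
      (∀ i j, st.A i j ≤ st.C i j) →
      ∀ i j, (U.foldl (sf2Step h g) st).A i j ≤ (U.foldl (sf2Step h g) st).C i j := by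
    intro U
    induction U with
    | nil => intro st hst; exact hst
    | cons op U ih => intro st hst; exact ih _ (step st op hst)
  exact fold U _ (fun _ _ => le_refl _)
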